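/- Let n ≥ 1, 1 ≤ m ≤ n, and let W be an n×n positive definite Hermitian matrix. (i) If A_1,…,A_m are n×n Hermitian matrices each of which is m-positive with respect to W, then D(A_1,…,A_m, W[n−m]) > 0. (ii) If A_1,…,A_{m−1} are Hermitian and m-positive with respect to W, then for every nonzero positive semidefinite Hermitian matrix B, D(B, A_1,…,A_{m−1}, W[n−m]) > 0. (iii) If p ≤ m and A_1,…,A_p are Hermitian matrices lying in the closure of the cone of matrices m-positive with respect to W, then for all positive semidefinite Hermitian matrices B_1,…,B_{m−p}, D(A_1,…,A_p, B_1,…,B_{m−p}, W[n−m]) ≥ 0. -/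

import Mathlib

open scoped ComplexOrder

namespace MixedDiscPaper

/-- The mixed discriminant of a list of `n` complex `n×n` matrices:
`(1/n!)` times the coefficient of `x_1⋯x_n` in `det(x_1 M_1 + … + x_n M_n)`
(its real part; for Hermitian matrices the value is real). -/
noncomputable def mixedDisc (n : ℕ) (L : List (Matrix (Fin n) (Fin n) ℂ)) : ℝ :=
  (((n.factorial : ℂ))⁻¹ *
    MvPolynomial.coeff (Finsupp.equivFunOnFinite.symm fun _ : Fin n => 1)
      (Matrix.det (Matrix.of fun i j : Fin n =>
        ∑ k : Fin n, MvPolynomial.X k * MvPolynomial.C ((L.getD (k : ℕ) 0) i j)))).re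

/-- `A` is `m`-positive with respect to `W`: `D(A[k], W[n−k]) > 0` for `1 ≤ k ≤ m`. -/
def IsMPos (n m : ℕ) (W A : Matrix (Fin n) (Fin n) ℂ) : Prop :=
  ∀ k : ℕ, 1 ≤ k → k ≤ m →
    0 < mixedDisc n (List.replicate k A ++ List.replicate (n - k) W)


/-- Complex mixed discriminant. -/
noncomputable def Dc (n : ℕ) (L : List (Matrix (Fin n) (Fin n) ℂ)) : ℂ :=
  (((n.factorial : ℂ))⁻¹ *
    MvPolynomial.coeff (Finsupp.equivFunOnFinite.symm fun _ : Fin n => 1)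
      (Matrix.det (Matrix.of fun i j : Fin n =>
        ∑ k : Fin n, MvPolynomial.X k * MvPolynomial.C ((L.getD (k : ℕ) 0) i j))))

lemma mixedDisc_eq (n : ℕ) (L : List (Matrix (Fin n) (Fin n) ℂ)) :
    mixedDisc n L = (Dc n L).re := rfl

lemma coeff_aux (n : ℕ) (M : Fin n → Matrix (Fin n) (Fin n) ℂ) :
    MvPolynomial.coeff (Finsupp.equivFunOnFinite.symm fun _ : Fin n => 1)
      (Matrix.det (Matrix.of fun i j : Fin n =>
        ∑ k : Fin n, MvPolynomial.X k * MvPolynomial.C (M k i j)))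
      = ∑ π : Equiv.Perm (Fin n), (Matrix.of fun i j => M (π i) i j).det := by
  classical
  have h1 : (Matrix.of fun i j : Fin n =>
        ∑ k : Fin n, (MvPolynomial.X k * MvPolynomial.C (M k i j) : MvPolynomial (Fin n) ℂ)) =
      (fun i => ∑ k : Fin n, (MvPolynomial.X k : MvPolynomial (Fin n) ℂ) •
        (fun j => (MvPolynomial.C (M k i j) : MvPolynomial (Fin n) ℂ))) := by
    funext i j
    simp [Finset.sum_apply]
  have h2 : ∀ A : Matrix (Fin n) (Fin n) (MvPolynomial (Fin n) ℂ),
      A.det = Matrix.detRowAlternating.toMultilinearMap A := fun A => rfl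
  rw [h2, h1, MultilinearMap.map_sum, MvPolynomial.coeff_sum]
  have h3 : ∀ r : Fin n → Fin n,
      MvPolynomial.coeff (Finsupp.equivFunOnFinite.symm fun _ : Fin n => 1)
      ((Matrix.detRowAlternating (R := MvPolynomial (Fin n) ℂ) (n := Fin n)).toMultilinearMap
        (fun i => (MvPolynomial.X (r i) : MvPolynomial (Fin n) ℂ) •
          (fun j => (MvPolynomial.C (M (r i) i j) : MvPolynomial (Fin n) ℂ))))
      = if Function.Bijective r then (Matrix.of fun i j => M (r i) i j).det else 0 := by
    intro r
    rw [MultilinearMap.map_smul_univ]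
    have h4 : (Matrix.detRowAlternating (R := MvPolynomial (Fin n) ℂ) (n := Fin n)).toMultilinearMap
          (fun i j => (MvPolynomial.C (M (r i) i j) : MvPolynomial (Fin n) ℂ)) =
        MvPolynomial.C (Matrix.of fun i j => M (r i) i j).det := by
      rw [RingHom.map_det]; rfl
    rw [h4, smul_eq_mul, mul_comm, MvPolynomial.coeff_C_mul]
    have h5 : (∏ i, (MvPolynomial.X (r i) : MvPolynomial (Fin n) ℂ)) =
        MvPolynomial.monomial (∑ i, Finsupp.single (r i) 1) 1 := by
      rw [MvPolynomial.monomial_sum_one]; rfl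
    rw [h5, MvPolynomial.coeff_monomial]
    have h6 : (∑ i, Finsupp.single (r i) 1 = Finsupp.equivFunOnFinite.symm fun _ : Fin n => 1) ↔
        Function.Bijective r := by
      constructor
      · intro h
        apply Function.Surjective.bijective_of_finite
        intro k
        by_contra hk
        push Not at hk
        have := DFunLike.congr_fun h k
        simp [hk] at this
      · intro h
        ext k
        obtain ⟨i, rfl⟩ := h.2 k
        simp [Finsupp.single_apply, h.1.eq_iff]
    simp only [h6]
    split_ifs <;> simp
  rw [Finset.sum_congr rfl (fun r _ => h3 r), ← Finset.sum_filter]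
  symm
  refine Finset.sum_bij (fun π _ => (π : Fin n → Fin n)) ?_ ?_ ?_ ?_
  · intro π _; exact Finset.mem_filter.2 ⟨Finset.mem_univ _, π.bijective⟩
  · intro a _ b _ h; exact Equiv.ext (fun x => congrFun h x)
  · intro r hr
    exact ⟨Equiv.ofBijective r (by simpa using hr), by simp, rfl⟩
  · intro π _; rfl

lemma Dc_eq (n : ℕ) (L : List (Matrix (Fin n) (Fin n) ℂ)) :
    Dc n L = ((n.factorial : ℂ))⁻¹ *
      ∑ π : Equiv.Perm (Fin n), (Matrix.of fun i j => (L.getD (π i : ℕ) 0) i j).det := by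
  unfold Dc
  rw [coeff_aux n (fun k => L.getD (k : ℕ) 0)]

lemma Dc_diag (n : ℕ) (X : Matrix (Fin n) (Fin n) ℂ) :
    Dc n (List.replicate n X) = X.det := by
  rw [Dc_eq]
  have : ∀ π : Equiv.Perm (Fin n),
      (Matrix.of fun i j => ((List.replicate n X).getD (π i : ℕ) 0) i j).det = X.det := by
    intro π
    congr 1
    ext i j
    simp [List.getD_eq_getElem?_getD]
  simp only [this, Finset.sum_const, Finset.card_univ, Fintype.card_perm, Fintype.card_fin,
    nsmul_eq_mul]
  have : (n.factorial : ℂ) ≠ 0 := by exact_mod_cast n.factorial_ne_zero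
  field_simp

lemma Dc_lin (n : ℕ) (hn : 1 ≤ n) (x y : Matrix (Fin n) (Fin n) ℂ) (c : ℂ)
    (L : List (Matrix (Fin n) (Fin n) ℂ)) :
    Dc n ((x + c • y) :: L) = Dc n (x :: L) + c * Dc n (y :: L) := by
  classical
  obtain ⟨N, rfl⟩ : ∃ N, n = N + 1 := ⟨n - 1, by omega⟩
  have key : ∀ (π : Equiv.Perm (Fin (N + 1))) (z : Matrix (Fin (N + 1)) (Fin (N + 1)) ℂ),
      (Matrix.of fun i j => ((z :: L).getD (π i : ℕ) 0) i j) =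
      (Matrix.of fun i j => (((0 : Matrix (Fin (N + 1)) (Fin (N + 1)) ℂ) :: L).getD
        (π i : ℕ) 0) i j).updateRow (π.symm 0) (z (π.symm 0)) := by
    intro π z
    ext i j
    by_cases h : i = π.symm 0
    · subst h; simp
    · have h' : π i ≠ 0 := by
        intro h0; apply h; rw [← h0]; simp
      rw [Matrix.updateRow_ne h]
      obtain ⟨k, hk⟩ := Fin.exists_succ_eq.2 h'
      simp [← hk]
  simp only [Dc_eq]
  have h2 : ∀ π : Equiv.Perm (Fin (N + 1)),
      (Matrix.of fun i j => (((x + c • y) :: L).getD (π i : ℕ) 0) i j).det =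
      (Matrix.of fun i j => ((x :: L).getD (π i : ℕ) 0) i j).det +
      c * (Matrix.of fun i j => ((y :: L).getD (π i : ℕ) 0) i j).det := by
    intro π
    rw [key π (x + c • y), key π x, key π y, ← Matrix.det_updateRow_smul,
      ← Matrix.det_updateRow_add]
    rfl
  rw [Finset.sum_congr rfl (fun π _ => h2 π), Finset.sum_add_distrib, ← Finset.mul_sum]
  ring

lemma Dc_perm_aux (n : ℕ) {L1 L2 : List (Matrix (Fin n) (Fin n) ℂ)} (h : L1.Perm L2) :
    ∀ pre : List (Matrix (Fin n) (Fin n) ℂ), pre.length + L1.length = n →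
      Dc n (pre ++ L1) = Dc n (pre ++ L2) := by
  induction h with
  | nil => intro pre _; rfl
  | cons x h ih =>
    intro pre hl
    have := ih (pre ++ [x]) (by simp at hl ⊢; omega)
    simpa using this
  | trans h1 h2 ih1 ih2 =>
    intro pre hl
    rw [ih1 pre hl, ih2 pre (by rw [← h1.length_eq]; exact hl)]
  | swap x y L =>
    intro pre hl
    simp only [List.length_cons] at hl
    have ha : pre.length < n := by omega
    have hb : pre.length + 1 < n := by omega
    rw [Dc_eq, Dc_eq]
    congr 1
    let τ : Equiv.Perm (Fin n) := Equiv.swap ⟨pre.length, ha⟩ ⟨pre.length + 1, hb⟩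
    refine Fintype.sum_equiv (Equiv.mulLeft τ) _ _ ?_
    intro π
    congr 1
    ext i j
    simp only [Matrix.of_apply, Equiv.coe_mulLeft, Equiv.Perm.coe_mul, Function.comp]
    generalize π i = k
    by_cases h1 : k = ⟨pre.length, ha⟩
    · subst h1
      simp [τ, List.getD_eq_getElem?_getD]
    · by_cases h2 : k = ⟨pre.length + 1, hb⟩
      · subst h2
        simp [τ, List.getD_eq_getElem?_getD]
      · have : τ k = k := Equiv.swap_apply_of_ne_of_ne h1 h2
        rw [this]
        obtain ⟨k, hk⟩ := k
        simp only [Fin.mk.injEq] at h1 h2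
        simp only [List.getD_eq_getElem?_getD, List.getElem?_append]
        split_ifs with h3
        · rfl
        · obtain ⟨q, hq⟩ : ∃ q, k - pre.length = q + 2 := ⟨k - pre.length - 2, by omega⟩
          rw [hq]; simp

lemma Dc_perm (n : ℕ) {L1 L2 : List (Matrix (Fin n) (Fin n) ℂ)} (h : L1.Perm L2)
    (hl : L1.length = n) : Dc n L1 = Dc n L2 := by
  simpa using Dc_perm_aux n h [] (by simpa using hl)

lemma Dc_im (n : ℕ) (L : List (Matrix (Fin n) (Fin n) ℂ)) (hL : ∀ X ∈ L, X.IsHermitian) :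
    (Dc n L).im = 0 := by
  rw [← Complex.conj_eq_iff_im]
  unfold Dc
  rw [map_mul, map_inv₀, map_natCast, ← MvPolynomial.coeff_map, RingHom.map_det,
    ← Matrix.det_transpose]
  congr 3
  ext1 i j
  have hM : ∀ k : ℕ, (L.getD k 0).IsHermitian := by
    intro k
    rw [List.getD_eq_getElem?_getD]
    by_cases h : k < L.length
    · simpa [h] using hL _ (List.getElem_mem h)
    · simp [h]
  simp only [Matrix.transpose_apply, RingHom.mapMatrix_apply, Matrix.map_apply, Matrix.of_apply,
    map_sum, map_mul, MvPolynomial.map_X, MvPolynomial.map_C]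
  refine Finset.sum_congr rfl fun k _ => ?_
  rw [← (hM k).apply i j]
  rfl

lemma Dc_cont (n : ℕ) {T : Type*} [TopologicalSpace T]
    (Ls : List (T → Matrix (Fin n) (Fin n) ℂ)) (h : ∀ f ∈ Ls, Continuous f) :
    Continuous fun s => Dc n (Ls.map fun f => f s) := by
  simp only [Dc_eq]
  refine continuous_const.mul (continuous_finsetSum _ fun π _ => Continuous.matrix_det ?_)
  refine continuous_matrix fun i j => ?_
  simp only [Matrix.of_apply]
  have : ∀ s, ((Ls.map fun f => f s).getD (π i : ℕ) 0) = (Ls.getD (π i : ℕ) 0) s := by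
    intro s
    simp only [List.getD_eq_getElem?_getD, List.getElem?_map]
    cases Ls[(π i : ℕ)]? <;> simp
  simp only [this]
  have hc : Continuous (Ls.getD (π i : ℕ) 0) := by
    rw [List.getD_eq_getElem?_getD]
    by_cases hk : (π i : ℕ) < Ls.length
    · simpa [hk] using h _ (List.getElem_mem hk)
    · simpa [hk] using (continuous_zero : Continuous (0 : T → Matrix (Fin n) (Fin n) ℂ))
  exact hc.matrix_elem i j

/-- Polynomial with given coefficients. -/
noncomputable def polyOf (k : ℕ) (c : ℕ → ℂ) : Polynomial ℂ :=
  ∑ j ∈ Finset.range (k + 1), Polynomial.C (c j) * Polynomial.X ^ j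

lemma polyOf_eval (k : ℕ) (c : ℕ → ℂ) (t : ℂ) :
    (polyOf k c).eval t = ∑ j ∈ Finset.range (k + 1), c j * t ^ j := by
  simp [polyOf, Polynomial.eval_finsetSum]

lemma polyOf_coeff (k : ℕ) (c : ℕ → ℂ) (j : ℕ) :
    (polyOf k c).coeff j = if j ≤ k then c j else 0 := by
  simp [polyOf, Polynomial.coeff_X_pow, Polynomial.finsetSum_coeff]

lemma polyOf_natDegree (k : ℕ) (c : ℕ → ℂ) (hc : c k ≠ 0) : (polyOf k c).natDegree = k := by
  apply Polynomial.natDegree_eq_of_le_of_coeff_ne_zero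
  · rw [Polynomial.natDegree_le_iff_coeff_eq_zero]
    intro N hN
    rw [polyOf_coeff, if_neg (by omega)]
  · rw [polyOf_coeff, if_pos le_rfl]; exact hc

lemma gauss_lucas_aux (k : ℕ) (c : ℕ → ℂ) (hc : c (k + 1) ≠ 0)
    (h : ∀ t : ℂ, 0 ≤ t.im → ∑ j ∈ Finset.range (k + 2), c j * t ^ j ≠ 0) : c 1 ≠ 0 := by
  intro h1
  have hd := polyOf_natDegree (k + 1) c hc
  have hdeg : 0 < (polyOf (k + 1) c).degree := by
    rw [← Polynomial.natDegree_pos_iff_degree_pos, hd]; omega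
  have hder : (polyOf (k + 1) c).derivative ≠ 0 := by
    intro h0
    have := Polynomial.derivative_eq_zero.1 h0
    omega
  have hroot : (0 : ℂ) ∈ (polyOf (k + 1) c).derivative.rootSet ℂ := by
    rw [Polynomial.mem_rootSet]
    refine ⟨hder, ?_⟩
    rw [Polynomial.coe_aeval_eq_eval, ← Polynomial.coeff_zero_eq_eval_zero,
      Polynomial.coeff_derivative, polyOf_coeff, if_pos (by omega)]
    simp [h1]
  have hmem := Polynomial.rootSet_derivative_subset_convexHull_rootSet hdeg hroot
  have hconv : Convex ℝ {z : ℂ | z.im < 0} := convex_halfSpace_im_lt 0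
  have hsub : (polyOf (k + 1) c).rootSet ℂ ⊆ {z : ℂ | z.im < 0} := by
    intro z hz
    rw [Polynomial.mem_rootSet, Polynomial.coe_aeval_eq_eval, polyOf_eval] at hz
    by_contra hz'
    exact h z (not_lt.1 hz') hz.2
  have := convexHull_min hsub hconv hmem
  simp at this

lemma lower_bound (k : ℕ) (c : ℕ → ℂ) (hc : c k ≠ 0)
    (h : ∀ t : ℂ, 0 ≤ t.im → ∑ j ∈ Finset.range (k + 1), c j * t ^ j ≠ 0) (t : ℂ)
    (ht : 0 ≤ t.im) : ‖c k‖ * t.im ^ k ≤ ‖∑ j ∈ Finset.range (k + 1), c j * t ^ j‖ := by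
  have hd := polyOf_natDegree k c hc
  have hs := IsAlgClosed.splits (polyOf k c)
  rw [← polyOf_eval, hs.eval_eq_prod_roots, norm_mul, Polynomial.leadingCoeff, hd, polyOf_coeff,
    if_pos le_rfl]
  gcongr
  have hcard : (polyOf k c).roots.card = k := by rw [← hs.natDegree_eq_card_roots, hd]
  have hne : polyOf k c ≠ 0 := by
    intro h0
    have := polyOf_coeff k c k
    rw [h0] at this; simp at this; exact hc this.symm
  have hroots : ∀ r ∈ (polyOf k c).roots, r.im < 0 := by
    intro r hr
    rw [Polynomial.mem_roots hne, Polynomial.IsRoot, polyOf_eval] at hr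
    by_contra hz'
    exact h r (not_lt.1 hz') hr
  conv_lhs => rw [← hcard]
  generalize (polyOf k c).roots = s at hroots
  induction s using Multiset.induction_on with
  | empty => simp
  | cons r s ih =>
    rw [Multiset.card_cons, pow_succ', Multiset.map_cons, Multiset.prod_cons, norm_mul]
    have h1 := ih (fun r hr => hroots r (Multiset.mem_cons_of_mem hr))
    have h2 := hroots r (Multiset.mem_cons_self _ _)
    have h3 : t.im ≤ ‖t - r‖ := by
      refine le_trans ?_ (Complex.abs_im_le_norm _)
      rw [Complex.sub_im]
      exact le_trans (by linarith) (le_abs_self _)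
    gcongr

lemma root_bound (k : ℕ) (c : ℕ → ℂ) (hc : c k ≠ 0) (t : ℂ)
    (h : ∑ j ∈ Finset.range (k + 1), c j * t ^ j = 0) :
    ‖t‖ ≤ 1 + (∑ j ∈ Finset.range k, ‖c j‖) / ‖c k‖ := by
  have hpos : 0 < ‖c k‖ := norm_pos_iff.2 hc
  have hnn : 0 ≤ (∑ j ∈ Finset.range k, ‖c j‖) / ‖c k‖ := by positivity
  by_cases ht : ‖t‖ ≤ 1
  · linarith
  push Not at ht
  rw [Finset.sum_range_succ] at h
  have h1 : ‖c k‖ * ‖t‖ ^ k = ‖∑ j ∈ Finset.range k, c j * t ^ j‖ := by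
    rw [← norm_pow, ← norm_mul, ← norm_neg, eq_neg_of_add_eq_zero_left h]
  have hk : k ≠ 0 := by
    rintro rfl
    simp at h; exact hc h
  obtain ⟨q, rfl⟩ := Nat.exists_eq_succ_of_ne_zero hk
  have h2 : ‖∑ j ∈ Finset.range (q + 1), c j * t ^ j‖ ≤
      (∑ j ∈ Finset.range (q + 1), ‖c j‖) * ‖t‖ ^ q := by
    rw [Finset.sum_mul]
    refine norm_sum_le_of_le _ fun j hj => ?_
    rw [norm_mul, norm_pow]
    gcongr
    · exact ht.le
    · simp at hj; omega
  have h3 : ‖c (q + 1)‖ * ‖t‖ ≤ ∑ j ∈ Finset.range (q + 1), ‖c j‖ := by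
    have hq : 0 < ‖t‖ ^ q := by positivity
    apply le_of_mul_le_mul_right _ hq
    rw [mul_assoc, ← pow_succ']
    exact h1.trans_le h2
  have h4 : ‖t‖ ≤ (∑ j ∈ Finset.range (q + 1), ‖c j‖) / ‖c (q + 1)‖ := by
    rw [le_div_iff₀ hpos]; linarith
  simp only [Nat.succ_eq_add_one]
  linarith

lemma homotopy_aux (k : ℕ) (c : ℕ → ℝ → ℂ) (hcont : ∀ j, Continuous (c j)) (c0 : ℂ) (hc0 : c0 ≠ 0)
    (hck : ∀ s, c k s = c0)
    (hreal : ∀ s t : ℝ, ∑ j ∈ Finset.range (k + 1), c j s * (t : ℂ) ^ j ≠ 0)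
    (h0 : ∀ t : ℂ, 0 ≤ t.im → ∑ j ∈ Finset.range (k + 1), c j 0 * t ^ j ≠ 0) (s : ℝ) :
    ∀ t : ℂ, 0 ≤ t.im → ∑ j ∈ Finset.range (k + 1), c j s * t ^ j ≠ 0 := by
  set U : Set ℝ := {s | ∀ t : ℂ, 0 ≤ t.im → ∑ j ∈ Finset.range (k + 1), c j s * t ^ j ≠ 0} with hU
  have hclosed : IsClosed U := by
    rw [← closure_subset_iff_isClosed]
    intro s hs t ht hz
    have htpos : 0 < t.im := by
      rcases ht.lt_or_eq with h | h
      · exact h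
      · exfalso
        apply hreal s t.re
        have : ((t.re : ℝ) : ℂ) = t := by apply Complex.ext <;> simp [← h]
        rw [this]; exact hz
    have hcl : IsClosed {s | ‖c0‖ * t.im ^ k ≤ ‖∑ j ∈ Finset.range (k + 1), c j s * t ^ j‖} := by
      apply isClosed_le continuous_const
      exact (continuous_finsetSum _ fun j _ => (hcont j).mul continuous_const).norm
    have hsub : U ⊆ {s | ‖c0‖ * t.im ^ k ≤ ‖∑ j ∈ Finset.range (k + 1), c j s * t ^ j‖} := by
      intro s' hs'
      have := lower_bound k (fun j => c j s') (by simpa [hck] using hc0) hs' t ht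
      simpa [hck] using this
    have := closure_minimal hsub hcl hs
    simp only [Set.mem_ofPred_eq, hz, norm_zero] at this
    have : 0 < ‖c0‖ * t.im ^ k := by have := norm_pos_iff.2 hc0; positivity
    linarith
  have hopen : IsClosed Uᶜ := by
    apply IsSeqClosed.isClosed
    intro u s hu hus
    have hmem : ∀ i, ∃ t : ℂ, 0 ≤ t.im ∧ ∑ j ∈ Finset.range (k + 1), c j (u i) * t ^ j = 0 := by
      intro i
      have := hu i
      simp only [hU, Set.mem_compl_iff, Set.mem_ofPred_eq] at this
      push Not at this
      exact this
    choose t ht hz using hmem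
    let g : ℝ → ℝ := fun s => 1 + (∑ j ∈ Finset.range k, ‖c j s‖) / ‖c0‖
    have hg : Continuous g := by
      refine continuous_const.add (Continuous.div_const ?_ _)
      exact continuous_finsetSum _ fun j _ => (hcont j).norm
    have hb : ∀ i, ‖t i‖ ≤ g (u i) := by
      intro i
      have := root_bound k (fun j => c j (u i)) (by simpa [hck] using hc0) (t i) (hz i)
      simpa [hck] using this
    obtain ⟨R, hR⟩ := ((hg.tendsto s).comp hus).bddAbove_range
    have hball : ∀ i, t i ∈ Metric.closedBall (0 : ℂ) R := by
      intro i
      rw [mem_closedBall_zero_iff]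
      exact (hb i).trans (hR ⟨i, rfl⟩)
    obtain ⟨a, -, φ, hφ, hlim⟩ := tendsto_subseq_of_bounded Metric.isBounded_closedBall hball
    have hus' := hus.comp hφ.tendsto_atTop
    intro hsU
    refine hsU a ?_ ?_
    · exact ge_of_tendsto' ((Complex.continuous_im.tendsto a).comp hlim) fun i => ht _
    · have hcc : Continuous fun p : ℝ × ℂ => ∑ j ∈ Finset.range (k + 1), c j p.1 * p.2 ^ j := by
        refine continuous_finsetSum _ fun j _ => ?_
        exact ((hcont j).comp continuous_fst).mul (continuous_snd.pow j)
      have hl := (hcc.tendsto (s, a)).comp (hus'.prodMk_nhds hlim)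
      refine tendsto_nhds_unique hl ?_
      have : (fun p : ℝ × ℂ => ∑ j ∈ Finset.range (k + 1), c j p.1 * p.2 ^ j) ∘
          (fun i => ((u ∘ φ) i, (t ∘ φ) i)) = fun _ => (0 : ℂ) := by
        funext i
        exact hz (φ i)
      rw [this]
      exact tendsto_const_nhds
  have hclopen : IsClopen U := ⟨hclosed, by simpa using hopen.isOpen_compl⟩
  rcases isClopen_iff.1 hclopen with h | h
  · exfalso
    have : (0 : ℝ) ∈ U := h0
    rw [h] at this; exact this
  · have : s ∈ U := by rw [h]; trivial
    exact this

lemma Dc_zero (n : ℕ) (hn : 1 ≤ n) (L : List (Matrix (Fin n) (Fin n) ℂ)) :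
    Dc n (0 :: L) = 0 := by
  have := Dc_lin n hn 0 0 1 L
  simpa using this

lemma Dc_smul (n : ℕ) (hn : 1 ≤ n) (c : ℂ) (y : Matrix (Fin n) (Fin n) ℂ)
    (L : List (Matrix (Fin n) (Fin n) ℂ)) : Dc n ((c • y) :: L) = c * Dc n (y :: L) := by
  have := Dc_lin n hn 0 y c L
  rwa [zero_add, Dc_zero n hn, zero_add] at this

lemma Dc_smul_rep (n : ℕ) (hn : 1 ≤ n) (c : ℂ) (y : Matrix (Fin n) (Fin n) ℂ) (k : ℕ) :
    ∀ R : List (Matrix (Fin n) (Fin n) ℂ), k + R.length = n →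
    Dc n (List.replicate k (c • y) ++ R) = c ^ k * Dc n (List.replicate k y ++ R) := by
  induction k with
  | zero => intro R _; simp
  | succ k ih =>
    intro R hR
    rw [List.replicate_succ, List.cons_append, Dc_smul n hn,
      Dc_perm n (L2 := List.replicate k (c • y) ++ y :: R) List.perm_middle.symm
        (by simp; omega), ih _ (by simp; omega), List.replicate_succ, List.cons_append,
      Dc_perm n (L2 := y :: (List.replicate k y ++ R)) List.perm_middle (by simp; omega)]
    ring

lemma Dc_expand_aux (n : ℕ) (hn : 1 ≤ n) (v a : Matrix (Fin n) (Fin n) ℂ) (t : ℂ) (k : ℕ) :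
    ∀ R : List (Matrix (Fin n) (Fin n) ℂ), k + R.length = n →
    Dc n (List.replicate k (v + t • a) ++ R) = ∑ ij ∈ Finset.HasAntidiagonal.antidiagonal k,
      k.choose ij.1 • (t ^ ij.1 * Dc n (List.replicate ij.1 a ++ List.replicate ij.2 v ++ R)) := by
  induction k with
  | zero => intro R _; simp
  | succ k ih =>
    intro R hR
    have e := Finset.sum_antidiagonal_choose_succ_nsmul
      (fun i j => t ^ i * Dc n (List.replicate i a ++ List.replicate j v ++ R)) k
    refine Eq.trans ?_ e.symm
    rw [List.replicate_succ, List.cons_append, Dc_lin n hn,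
      Dc_perm n (L1 := v :: _) (L2 := List.replicate k (v + t • a) ++ v :: R)
        List.perm_middle.symm (by simp; omega),
      Dc_perm n (L1 := a :: _) (L2 := List.replicate k (v + t • a) ++ a :: R)
        List.perm_middle.symm (by simp; omega),
      ih _ (by simp; omega), ih _ (by simp; omega), Finset.mul_sum]
    refine congrArg₂ (fun p q : ℂ => p + q) ?_ ?_
    · refine Finset.sum_congr rfl fun ij hij => ?_
      rw [Finset.HasAntidiagonal.mem_antidiagonal] at hij
      congr 2
      apply Dc_perm n _ (by simp; omega)
      rw [List.append_assoc, List.append_assoc]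
      refine List.Perm.append_left _ ?_
      rw [List.replicate_succ]
      exact List.perm_middle
    · refine Finset.sum_congr rfl fun ij hij => ?_
      rw [Finset.HasAntidiagonal.mem_antidiagonal] at hij
      have hc : k.choose ij.1 = k.choose ij.2 := by
        rw [← hij, Nat.choose_symm_add]
      rw [hc, mul_smul_comm, ← mul_assoc, ← pow_succ']
      congr 2
      apply Dc_perm n _ (by simp; omega)
      rw [List.replicate_succ, List.cons_append, List.cons_append]
      exact List.perm_middle

/-- Coefficients of `t ↦ D((v + t a)[k], R)`. -/
noncomputable def cf (n k : ℕ) (R : List (Matrix (Fin n) (Fin n) ℂ))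
    (v a : Matrix (Fin n) (Fin n) ℂ) (j : ℕ) : ℂ :=
  (k.choose j : ℂ) * Dc n (List.replicate j a ++ List.replicate (k - j) v ++ R)

lemma Dc_expand (n : ℕ) (hn : 1 ≤ n) (v a : Matrix (Fin n) (Fin n) ℂ) (t : ℂ) (k : ℕ)
    (R : List (Matrix (Fin n) (Fin n) ℂ)) (hR : k + R.length = n) :
    Dc n (List.replicate k (v + t • a) ++ R) =
      ∑ j ∈ Finset.range (k + 1), cf n k R v a j * t ^ j := by
  rw [Dc_expand_aux n hn v a t k R hR]
  rw [Finset.Nat.sum_antidiagonal_eq_sum_range_succ (fun i j =>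
    k.choose i • (t ^ i * Dc n (List.replicate i a ++ List.replicate j v ++ R)))]
  refine Finset.sum_congr rfl fun j _ => ?_
  simp only [cf, nsmul_eq_mul]
  ring

lemma cf_top (n k : ℕ) (R : List (Matrix (Fin n) (Fin n) ℂ))
    (v a : Matrix (Fin n) (Fin n) ℂ) : cf n k R v a k = Dc n (List.replicate k a ++ R) := by
  simp [cf]

lemma cf_cont (n k : ℕ) (R : List (Matrix (Fin n) (Fin n) ℂ))
    (v : ℝ → Matrix (Fin n) (Fin n) ℂ) (hv : Continuous v) (a : Matrix (Fin n) (Fin n) ℂ) (j : ℕ) :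
    Continuous fun s => cf n k R (v s) a j := by
  unfold cf
  refine continuous_const.mul ?_
  have := Dc_cont n (T := ℝ) (List.replicate j (fun _ => a) ++ List.replicate (k - j) v ++
    R.map (fun X _ => X)) (by
      intro f hf
      simp only [List.mem_append, List.mem_map, List.mem_replicate] at hf
      rcases hf with (⟨_, rfl⟩ | ⟨_, rfl⟩) | ⟨X, _, rfl⟩
      · exact continuous_const
      · exact hv
      · exact continuous_const)
  simpa [Function.comp_def] using this

lemma herm_smul {n : ℕ} {A : Matrix (Fin n) (Fin n) ℂ} (hA : A.IsHermitian) (r : ℝ) :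
    ((r : ℂ) • A).IsHermitian := by
  unfold Matrix.IsHermitian
  rw [Matrix.conjTranspose_smul, hA.eq]
  simp

lemma posDef_smul {n : ℕ} {A : Matrix (Fin n) (Fin n) ℂ} (hA : A.PosDef) (r : ℝ) (hr : 0 < r) :
    ((r : ℂ) • A).PosDef := by
  apply Matrix.PosDef.smul hA
  exact_mod_cast hr

lemma complex_split {n : ℕ} (x y a : Matrix (Fin n) (Fin n) ℂ) (t : ℂ) :
    x + Complex.I • y + t • a =
      (x + (t.re : ℂ) • a) + Complex.I • (y + (t.im : ℂ) • a) := by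
  conv_lhs => rw [← Complex.re_add_im t]
  module

lemma deriv_lemma (n : ℕ) (hn : 1 ≤ n) (K : Set (Matrix (Fin n) (Fin n) ℂ))
    (hK : ∀ y ∈ K, y.IsHermitian) (hadd : ∀ y ∈ K, ∀ z ∈ K, y + z ∈ K)
    (hsmul : ∀ y ∈ K, ∀ r : ℝ, 0 < r → (r : ℂ) • y ∈ K) (k : ℕ)
    (R : List (Matrix (Fin n) (Fin n) ℂ)) (hR : k + 1 + R.length = n)
    (h : ∀ x y : Matrix (Fin n) (Fin n) ℂ, x.IsHermitian → y ∈ K →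
      Dc n (List.replicate (k + 1) (x + Complex.I • y) ++ R) ≠ 0)
    (a : Matrix (Fin n) (Fin n) ℂ) (ha : a ∈ K) (x y : Matrix (Fin n) (Fin n) ℂ)
    (hx : x.IsHermitian) (hy : y ∈ K) :
    Dc n (List.replicate k (x + Complex.I • y) ++ a :: R) ≠ 0 := by
  have htop : Dc n (List.replicate (k + 1) a ++ R) ≠ 0 := by
    intro h0
    apply h 0 a Matrix.isHermitian_zero ha
    rw [zero_add, Dc_smul_rep n hn _ _ _ _ hR, h0, mul_zero]
  have := gauss_lucas_aux k (cf n (k + 1) R (x + Complex.I • y) a)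
    (by rw [cf_top]; exact htop) (by
      intro t ht
      rw [← Dc_expand n hn _ _ _ _ _ hR, complex_split]
      apply h
      · exact hx.add (herm_smul (hK a ha) _)
      · rcases ht.lt_or_eq with h1 | h1
        · exact hadd _ hy _ (hsmul _ ha _ h1)
        · rw [← h1]; simpa using hy)
  unfold cf at this
  have h2 := right_ne_zero_of_mul this
  rw [Dc_perm n (L2 := a :: (List.replicate k (x + Complex.I • y) ++ R)) List.perm_middle
    (by simp; omega)]
  simpa using h2

lemma det_stable {n : ℕ} (x y : Matrix (Fin n) (Fin n) ℂ) (hx : x.IsHermitian) (hy : y.PosDef) :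
    (x + Complex.I • y).det ≠ 0 := by
  intro h
  obtain ⟨v, hv, hz⟩ := Matrix.exists_mulVec_eq_zero_iff.2 h
  have h1 := hy.dotProduct_mulVec_pos hv
  have h2 : star v ⬝ᵥ ((x + Complex.I • y).mulVec v) = 0 := by rw [hz]; simp
  rw [Matrix.add_mulVec, Matrix.smul_mulVec, dotProduct_add, dotProduct_smul] at h2
  have h3 : (star v ⬝ᵥ x.mulVec v).im = 0 := hx.im_star_dotProduct_mulVec_self v
  have h4 := congrArg Complex.im h2
  rw [Complex.lt_def] at h1
  simp [h3] at h4
  simp at h1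
  linarith [h1.1]

/-- `p(X) = D(X[m], W[n-m])`. -/
noncomputable def pp (n m : ℕ) (W X : Matrix (Fin n) (Fin n) ℂ) : ℂ :=
  Dc n (List.replicate m X ++ List.replicate (n - m) W)

lemma posDef_stable (n : ℕ) (hn : 1 ≤ n) (W : Matrix (Fin n) (Fin n) ℂ) (hW : W.PosDef) (j : ℕ) :
    ∀ k, k + j = n → ∀ x y : Matrix (Fin n) (Fin n) ℂ, x.IsHermitian → y.PosDef →
      Dc n (List.replicate k (x + Complex.I • y) ++ List.replicate j W) ≠ 0 := by
  induction j with
  | zero =>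
    intro k hk x y hx hy
    obtain rfl : k = n := by omega
    simpa [Dc_diag] using det_stable x y hx hy
  | succ j ih =>
    intro k hk x y hx hy
    exact deriv_lemma n hn {y | y.PosDef} (fun y hy => hy.isHermitian)
      (fun y hy z hz => Matrix.PosDef.add hy hz) (fun y hy r hr => posDef_smul hy r hr) k
      (List.replicate j W) (by simp; omega)
      (fun x y hx hy => ih (k + 1) (by omega) x y hx hy) W hW x y hx hy

section garding
variable {n m : ℕ} {W : Matrix (Fin n) (Fin n) ℂ}

lemma pp_stable (hn : 1 ≤ n) (hmn : m ≤ n) (hW : W.PosDef) (x y : Matrix (Fin n) (Fin n) ℂ)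
    (hx : x.IsHermitian) (hy : y.PosDef) : pp n m W (x + Complex.I • y) ≠ 0 :=
  posDef_stable n hn W hW (n - m) m (by omega) x y hx hy

lemma pp_smul (hn : 1 ≤ n) (hmn : m ≤ n) (c : ℂ) (X : Matrix (Fin n) (Fin n) ℂ) :
    pp n m W (c • X) = c ^ m * pp n m W X :=
  Dc_smul_rep n hn c X m _ (by simp; omega)

lemma pp_expand (hn : 1 ≤ n) (hmn : m ≤ n) (v a : Matrix (Fin n) (Fin n) ℂ) (t : ℂ) :
    pp n m W (v + t • a) =
      ∑ j ∈ Finset.range (m + 1), cf n m (List.replicate (n - m) W) v a j * t ^ j :=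
  Dc_expand n hn v a t m _ (by simp; omega)

/-- The Garding cone. -/
def GS (n m : ℕ) (W : Matrix (Fin n) (Fin n) ℂ) : Set (Matrix (Fin n) (Fin n) ℂ) :=
  {A | A.IsHermitian ∧ ∀ t : ℝ, 0 ≤ t → pp n m W (A + (t : ℂ) • W) ≠ 0}

lemma GS_pp {a : Matrix (Fin n) (Fin n) ℂ} (ha : a ∈ GS n m W) : pp n m W a ≠ 0 := by
  simpa using ha.2 0 le_rfl

lemma pp_hyp (hn : 1 ≤ n) (hmn : m ≤ n) (hW : W.PosDef) (x : Matrix (Fin n) (Fin n) ℂ)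
    (hx : x.IsHermitian) (μ : ℂ) (hμ : μ.im ≠ 0) : pp n m W (x + μ • W) ≠ 0 := by
  have key : ∀ (x : Matrix (Fin n) (Fin n) ℂ) (μ : ℂ), x.IsHermitian → 0 < μ.im →
      pp n m W (x + μ • W) ≠ 0 := by
    intro x μ hx hμ
    have := pp_stable hn hmn hW (x + (μ.re : ℂ) • W) ((μ.im : ℂ) • W)
      (hx.add (herm_smul hW.isHermitian _)) (posDef_smul hW _ hμ)
    convert this using 2
    conv_lhs => rw [← Complex.re_add_im μ]
    module
  rcases lt_or_gt_of_ne hμ with h | h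
  · have h1 := key (-x) (-μ) hx.neg (by simpa using h)
    have h2 : -x + (-μ) • W = (-1 : ℂ) • (x + μ • W) := by module
    rw [h2, pp_smul hn hmn] at h1
    exact right_ne_zero_of_mul h1
  · exact key x μ hx h

lemma homotopy_pp (hn : 1 ≤ n) (hmn : m ≤ n) (a : Matrix (Fin n) (Fin n) ℂ)
    (ha : pp n m W a ≠ 0) (v : ℝ → Matrix (Fin n) (Fin n) ℂ) (hv : Continuous v)
    (hreal : ∀ s t : ℝ, pp n m W (v s + (t : ℂ) • a) ≠ 0)
    (h0 : ∀ t : ℂ, 0 ≤ t.im → pp n m W (v 0 + t • a) ≠ 0) (t : ℂ) (ht : 0 ≤ t.im) :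
    pp n m W (v 1 + t • a) ≠ 0 := by
  simp only [pp_expand hn hmn] at hreal h0 ⊢
  exact homotopy_aux m (fun j s => cf n m (List.replicate (n - m) W) (v s) a j)
    (fun j => cf_cont n m _ v hv a j) (pp n m W a) ha (fun s => cf_top _ _ _ _ _) hreal h0 1 t ht

lemma garding0 (hn : 1 ≤ n) (hmn : m ≤ n) (hW : W.PosDef) (a : Matrix (Fin n) (Fin n) ℂ)
    (ha : a ∈ GS n m W) (α : ℝ) (hα : 0 < α) (t : ℂ) (ht : 0 ≤ t.im) :
    pp n m W ((Complex.I * α) • W + t • a) ≠ 0 := by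
  by_cases h0 : t = 0
  · subst h0
    have := pp_hyp hn hmn hW 0 Matrix.isHermitian_zero (Complex.I * α) (by simpa using hα.ne')
    simpa using this
  have e : (Complex.I * α) • W + t • a = t • (a + (Complex.I * α / t) • W) := by
    rw [smul_add, smul_smul, mul_div_cancel₀ _ h0, add_comm]
  rw [e, pp_smul hn hmn]
  refine mul_ne_zero (pow_ne_zero _ h0) ?_
  set μ : ℂ := Complex.I * α / t with hμ
  by_cases him : μ.im = 0
  · have hre : ((μ.re : ℝ) : ℂ) = μ := by apply Complex.ext <;> simp [him]
    rw [← hre]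
    apply ha.2
    rw [hμ, Complex.div_re]
    simp only [Complex.mul_re, Complex.I_re, Complex.ofReal_re, Complex.I_im, Complex.ofReal_im,
      Complex.mul_im]
    have := Complex.normSq_nonneg t
    simp
    positivity
  · exact pp_hyp hn hmn hW a ha.1 μ him

lemma garding1 (hn : 1 ≤ n) (hmn : m ≤ n) (hW : W.PosDef) (a x : Matrix (Fin n) (Fin n) ℂ)
    (ha : a ∈ GS n m W) (hx : x.IsHermitian) (α : ℝ) (hα : 0 < α) (t : ℂ) (ht : 0 ≤ t.im) :
    pp n m W (x + (Complex.I * α) • W + t • a) ≠ 0 := by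
  have := homotopy_pp hn hmn a (GS_pp ha)
    (fun s : ℝ => (s : ℂ) • x + (Complex.I * α) • W)
    (by
      refine Continuous.add ?_ continuous_const
      exact Complex.continuous_ofReal.smul continuous_const)
    (by
      intro s t
      have := pp_hyp hn hmn hW ((s : ℂ) • x + (t : ℂ) • a)
        ((herm_smul hx s).add (herm_smul ha.1 t)) (Complex.I * α) (by simpa using hα.ne')
      convert this using 2
      module)
    (by
      intro t ht
      simpa using garding0 hn hmn hW a ha α hα t ht) t ht
  simpa using this

lemma garding2 (hn : 1 ≤ n) (hmn : m ≤ n) (hW : W.PosDef) (a b x : Matrix (Fin n) (Fin n) ℂ)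
    (ha : a ∈ GS n m W) (hb : b ∈ GS n m W) (hx : x.IsHermitian) (α : ℝ) (hα : 0 < α) (t : ℂ)
    (ht : 0 ≤ t.im) :
    pp n m W (x + (Complex.I * α) • W + Complex.I • a + t • b) ≠ 0 := by
  have := homotopy_pp hn hmn b (GS_pp hb)
    (fun s : ℝ => x + (Complex.I * α) • W + (Complex.I * (s : ℂ) ^ 2) • a)
    (by
      refine Continuous.add continuous_const ?_
      exact (continuous_const.mul (Complex.continuous_ofReal.pow 2)).smul continuous_const)
    (by
      intro s t
      have := garding1 hn hmn hW a (x + (t : ℂ) • b) ha (hx.add (herm_smul hb.1 t)) α hα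
        (Complex.I * (s : ℂ) ^ 2) (by
          rw [← Complex.ofReal_pow]; simp [-Complex.ofReal_pow]; positivity)
      convert this using 2
      module)
    (by
      intro t ht
      simpa using garding1 hn hmn hW b x hb hx α hα t ht) t ht
  simpa using this

lemma pp_cont_line (a b : Matrix (Fin n) (Fin n) ℂ) :
    Continuous fun t : ℝ => pp n m W (a + (t : ℂ) • b) := by
  have := Dc_cont n (T := ℝ) (List.replicate m (fun t : ℝ => a + (t : ℂ) • b) ++
    List.replicate (n - m) (fun _ => W)) (by
      intro f hf
      simp only [List.mem_append, List.mem_replicate] at hf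
      rcases hf with ⟨_, rfl⟩ | ⟨_, rfl⟩
      · exact continuous_const.add (Complex.continuous_ofReal.smul continuous_const)
      · exact continuous_const)
  simpa [pp] using this

lemma GS_eps (hW : W.PosDef) (a : Matrix (Fin n) (Fin n) ℂ) (ha : a ∈ GS n m W) :
    ∃ ε : ℝ, 0 < ε ∧ a - (ε : ℂ) • W ∈ GS n m W := by
  have hc := (pp_cont_line (m := m) (W := W) a W).continuousAt (x := 0)
  have hne := hc.eventually_ne (ha.2 0 le_rfl)
  obtain ⟨δ, hδ, h⟩ := Metric.eventually_nhds_iff.1 hne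
  refine ⟨δ / 2, by positivity, ha.1.sub (herm_smul hW.isHermitian _), ?_⟩
  intro t ht
  have e : a - ((δ / 2 : ℝ) : ℂ) • W + (t : ℂ) • W = a + ((t - δ / 2 : ℝ) : ℂ) • W := by
    push_cast; module
  rw [e]
  by_cases h1 : 0 ≤ t - δ / 2
  · exact ha.2 _ h1
  · apply h
    rw [Real.dist_eq, abs_lt]
    constructor <;> linarith

lemma GS_addW (hW : W.PosDef) (a : Matrix (Fin n) (Fin n) ℂ) (ha : a ∈ GS n m W) (t : ℝ)
    (ht : 0 ≤ t) : a + (t : ℂ) • W ∈ GS n m W := by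
  refine ⟨ha.1.add (herm_smul hW.isHermitian _), fun s hs => ?_⟩
  have := ha.2 (t + s) (by positivity)
  convert this using 2
  push_cast; module

lemma GS_stable (hn : 1 ≤ n) (hmn : m ≤ n) (hW : W.PosDef) (x y : Matrix (Fin n) (Fin n) ℂ)
    (hx : x.IsHermitian) (hy : y ∈ GS n m W) : pp n m W (x + Complex.I • y) ≠ 0 := by
  obtain ⟨ε, hε, h⟩ := GS_eps hW y hy
  have := garding1 hn hmn hW _ x h hx ε hε Complex.I (by simp)
  convert this using 2
  module

lemma GS_add (hn : 1 ≤ n) (hmn : m ≤ n) (hW : W.PosDef) (a b : Matrix (Fin n) (Fin n) ℂ)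
    (ha : a ∈ GS n m W) (hb : b ∈ GS n m W) : a + b ∈ GS n m W := by
  refine ⟨ha.1.add hb.1, fun t ht => ?_⟩
  obtain ⟨ε, hε, h⟩ := GS_eps hW a ha
  have := garding2 hn hmn hW _ _ 0 h (GS_addW hW b hb t ht) Matrix.isHermitian_zero ε hε Complex.I
    (by simp)
  have e : 0 + (Complex.I * ε) • W + Complex.I • (a - (ε : ℂ) • W) +
      Complex.I • (b + (t : ℂ) • W) = Complex.I • (a + b + (t : ℂ) • W) := by module
  rw [e, pp_smul hn hmn] at this
  exact right_ne_zero_of_mul this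

lemma GS_smul (hn : 1 ≤ n) (hmn : m ≤ n) (a : Matrix (Fin n) (Fin n) ℂ)
    (ha : a ∈ GS n m W) (r : ℝ) (hr : 0 < r) : (r : ℂ) • a ∈ GS n m W := by
  refine ⟨herm_smul ha.1 r, fun t ht => ?_⟩
  have h := ha.2 (t / r) (by positivity)
  have hr' : (r : ℂ) ≠ 0 := by exact_mod_cast hr.ne'
  have e : (r : ℂ) • a + (t : ℂ) • W = (r : ℂ) • (a + ((t / r : ℝ) : ℂ) • W) := by
    rw [smul_add, smul_smul]; push_cast; rw [mul_div_cancel₀ _ hr']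
  rw [e, pp_smul hn hmn]
  exact mul_ne_zero (pow_ne_zero _ hr') h

lemma GS_posDef (hn : 1 ≤ n) (hmn : m ≤ n) (hW : W.PosDef) (a : Matrix (Fin n) (Fin n) ℂ)
    (ha : a.PosDef) : a ∈ GS n m W := by
  have key : ∀ b : Matrix (Fin n) (Fin n) ℂ, b.PosDef → pp n m W b ≠ 0 := by
    intro b hb
    have := pp_stable hn hmn hW 0 b Matrix.isHermitian_zero hb
    rw [zero_add, pp_smul hn hmn] at this
    exact right_ne_zero_of_mul this
  refine ⟨ha.isHermitian, fun t ht => ?_⟩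
  rcases ht.lt_or_eq with h | h
  · exact key _ (ha.add (posDef_smul hW _ h))
  · rw [← h]; simpa using key _ ha

end garding

lemma det_re_pos {n : ℕ} {W : Matrix (Fin n) (Fin n) ℂ} (hW : W.PosDef) : 0 < W.det.re := by
  have := hW.det_pos
  rw [Complex.lt_def] at this
  simpa using this.1

lemma GS_of_mpos {n m : ℕ} {W : Matrix (Fin n) (Fin n) ℂ} (hn : 1 ≤ n) (hm : 1 ≤ m) (hmn : m ≤ n)
    (hW : W.PosDef) (A : Matrix (Fin n) (Fin n) ℂ) (hA : A.IsHermitian) (h : IsMPos n m W A) :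
    A ∈ GS n m W := by
  refine ⟨hA, fun t ht h0 => ?_⟩
  have hre := congrArg Complex.re h0
  rw [pp_expand hn hmn, Complex.re_sum, Complex.zero_re] at hre
  have hcf : ∀ j ∈ Finset.range (m + 1), 0 < (cf n m (List.replicate (n - m) W) A W j).re := by
    intro j hj
    rw [Finset.mem_range] at hj
    unfold cf
    rw [← Complex.ofReal_natCast, Complex.re_ofReal_mul]
    refine mul_pos (by exact_mod_cast Nat.choose_pos (by omega)) ?_
    rw [Dc_perm n (L2 := List.replicate (m - j) A ++ List.replicate (n - (m - j)) W) ?_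
      (by simp; omega)]
    · by_cases hjm : j = m
      · subst hjm
        simp only [Nat.sub_self, List.replicate_zero, List.nil_append, Nat.sub_zero, Dc_diag]
        exact det_re_pos hW
      · exact h (m - j) (by omega) (by omega)
    · have e : n - (m - j) = j + (n - m) := by omega
      rw [e, List.replicate_add, ← List.append_assoc]
      exact List.Perm.append_right _ List.perm_append_comm
  have hpos : 0 < ∑ j ∈ Finset.range (m + 1),
      (cf n m (List.replicate (n - m) W) A W j * (t : ℂ) ^ j).re := by
    apply Finset.sum_pos'
    · intro j hj
      rw [← Complex.ofReal_pow, Complex.re_mul_ofReal]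
      exact mul_nonneg (hcf j hj).le (by positivity)
    · refine ⟨0, by simp, ?_⟩
      simpa using hcf 0 (by simp)
  linarith

section final
variable {n m : ℕ} {W : Matrix (Fin n) (Fin n) ℂ}

lemma GS_ne (hn : 1 ≤ n) (hmn : m ≤ n) (hW : W.PosDef)
    (L : List (Matrix (Fin n) (Fin n) ℂ)) (hL : ∀ a ∈ L, a ∈ GS n m W) :
    ∀ k, k + L.length = m → ∀ x y : Matrix (Fin n) (Fin n) ℂ, x.IsHermitian → y ∈ GS n m W →
      Dc n (List.replicate k (x + Complex.I • y) ++ (L ++ List.replicate (n - m) W)) ≠ 0 := by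
  induction L with
  | nil =>
    intro k hk x y hx hy
    obtain rfl : k = m := by simpa using hk
    exact GS_stable hn hmn hW x y hx hy
  | cons a L ih =>
    intro k hk x y hx hy
    simp only [List.length_cons] at hk
    exact deriv_lemma n hn (GS n m W) (fun y hy => hy.1)
      (fun y hy z hz => GS_add hn hmn hW y z hy hz) (fun y hy r hr => GS_smul hn hmn y hy r hr) k
      (L ++ List.replicate (n - m) W) (by simp; omega)
      (fun x y hx hy => ih (fun a ha => hL a (List.mem_cons_of_mem _ ha)) (k + 1) (by omega)
        x y hx hy) a (hL a List.mem_cons_self) x y hx hy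

lemma GS_pos (hn : 1 ≤ n) (hmn : m ≤ n) (hW : W.PosDef)
    (L : List (Matrix (Fin n) (Fin n) ℂ)) (hL : ∀ a ∈ L, a ∈ GS n m W) (hlen : L.length = m) :
    0 < (Dc n (L ++ List.replicate (n - m) W)).re := by
  have hWG : W ∈ GS n m W := GS_posDef hn hmn hW W hW
  let f : ℝ → ℝ := fun s =>
    (Dc n (L.map (fun a => ((1 - s : ℝ) : ℂ) • a + (s : ℂ) • W) ++ List.replicate (n - m) W)).re
  have hf : Continuous f := by
    have := Dc_cont n (T := ℝ) (L.map (fun a (s : ℝ) => ((1 - s : ℝ) : ℂ) • a + (s : ℂ) • W) ++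
      List.replicate (n - m) (fun _ => W)) (by
        intro f hf
        simp only [List.mem_append, List.mem_map, List.mem_replicate] at hf
        rcases hf with ⟨a, _, rfl⟩ | ⟨_, rfl⟩
        · refine Continuous.add ?_ (Complex.continuous_ofReal.smul continuous_const)
          exact (Complex.continuous_ofReal.comp
            (continuous_const.sub continuous_id)).smul continuous_const
        · exact continuous_const)
    refine Complex.continuous_re.comp ?_
    simpa [Function.comp_def] using this
  have hne : ∀ s ∈ Set.Icc (0 : ℝ) 1, f s ≠ 0 := by
    intro s hs h0
    have hmem : ∀ a ∈ L.map (fun a => ((1 - s : ℝ) : ℂ) • a + (s : ℂ) • W), a ∈ GS n m W := by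
      intro b hb
      obtain ⟨a, ha, rfl⟩ := List.mem_map.1 hb
      rcases hs.1.lt_or_eq with h1 | h1
      · rcases hs.2.lt_or_eq with h2 | h2
        · exact GS_add hn hmn hW _ _ (GS_smul hn hmn _ (hL a ha) _ (by linarith))
            (GS_smul hn hmn _ hWG _ h1)
        · subst h2; simpa using hWG
      · subst h1; simpa using hL a ha
    have h1 := GS_ne hn hmn hW _ hmem 0 (by simpa using hlen) 0 W Matrix.isHermitian_zero hWG
    apply h1
    refine Complex.ext h0 (Dc_im n _ ?_)
    intro X hX
    simp only [List.replicate_zero, List.nil_append, List.mem_append, List.mem_replicate] at hX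
    rcases hX with hX | ⟨_, rfl⟩
    · exact (hmem X hX).1
    · exact hW.isHermitian
  have hf1 : 0 < f 1 := by
    simp only [f]
    have : (L.map (fun a => ((1 - 1 : ℝ) : ℂ) • a + ((1 : ℝ) : ℂ) • W) ++
        List.replicate (n - m) W) = List.replicate n W := by
      simp only [sub_self, Complex.ofReal_zero, zero_smul, Complex.ofReal_one, one_smul, zero_add]
      rw [List.map_const', ← List.replicate_add, hlen]
      congr 1; omega
    rw [this, Dc_diag]
    exact det_re_pos hW
  have hf0 : f 0 = (Dc n (L ++ List.replicate (n - m) W)).re := by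
    simp [f]
  rw [← hf0]
  by_contra hcon
  obtain ⟨s, hs, hs0⟩ := intermediate_value_Icc zero_le_one hf.continuousOn
    (⟨not_lt.1 hcon, hf1.le⟩ : (0 : ℝ) ∈ Set.Icc (f 0) (f 1))
  exact hne s hs hs0

lemma closure_nonneg (hn : 1 ≤ n) (hmn : m ≤ n) (hW : W.PosDef)
    (L1 : List (Matrix (Fin n) (Fin n) ℂ)) (h1 : ∀ a ∈ L1, a ∈ closure (GS n m W)) :
    ∀ L2 : List (Matrix (Fin n) (Fin n) ℂ), (∀ a ∈ L2, a ∈ GS n m W) →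
      L1.length + L2.length = m → 0 ≤ (Dc n (L1 ++ (L2 ++ List.replicate (n - m) W))).re := by
  induction L1 with
  | nil =>
    intro L2 h2 hl
    exact (GS_pos hn hmn hW L2 h2 (by simpa using hl)).le
  | cons a L1 ih =>
    intro L2 h2 hl
    simp only [List.length_cons] at hl
    have hcl : IsClosed {b | 0 ≤ (Dc n (b :: (L1 ++ (L2 ++ List.replicate (n - m) W)))).re} := by
      refine isClosed_le continuous_const (Complex.continuous_re.comp ?_)
      have := Dc_cont n (T := Matrix (Fin n) (Fin n) ℂ) (id ::
        (L1 ++ (L2 ++ List.replicate (n - m) W)).map (fun X _ => X)) (by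
          intro f hf
          rcases List.mem_cons.1 hf with rfl | hf
          · exact continuous_id
          · obtain ⟨X, _, rfl⟩ := List.mem_map.1 hf
            exact continuous_const)
      simpa [Function.comp_def] using this
    have hsub : GS n m W ⊆
        {b | 0 ≤ (Dc n (b :: (L1 ++ (L2 ++ List.replicate (n - m) W)))).re} := by
      intro b hb
      have := ih (fun a ha => h1 a (List.mem_cons_of_mem _ ha)) (b :: L2) (by
        intro c hc
        rcases List.mem_cons.1 hc with rfl | hc
        · exact hb
        · exact h2 c hc) (by simp; omega)
      rw [List.cons_append, Dc_perm n (L2 := b :: (L1 ++ (L2 ++ List.replicate (n - m) W)))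
        List.perm_middle (by simp; omega)] at this
      exact this
    exact closure_minimal hsub hcl (h1 a List.mem_cons_self)

lemma psd_closure (hn : 1 ≤ n) (hmn : m ≤ n) (hW : W.PosDef) (B : Matrix (Fin n) (Fin n) ℂ)
    (hB : B.PosSemidef) : B ∈ closure (GS n m W) := by
  have hc : Continuous fun t : ℝ => B + (t : ℂ) • W :=
    continuous_const.add (Complex.continuous_ofReal.smul continuous_const)
  have h0 : (0 : ℝ) ∈ closure (Set.Ioi (0 : ℝ)) := by simp
  have := map_mem_closure hc h0 (t := GS n m W) (fun t ht =>
    GS_posDef hn hmn hW _ (Matrix.PosDef.posSemidef_add hB (posDef_smul hW t ht)))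
  simpa using this

lemma trace_inv_pos (hW : W.PosDef) (B : Matrix (Fin n) (Fin n) ℂ)
    (hB : B.PosSemidef) (hB0 : B ≠ 0) : 0 < (W⁻¹ * B).trace := by
  open scoped MatrixOrder in
  obtain ⟨C, hC⟩ := CStarAlgebra.nonneg_iff_eq_star_mul_self.mp hW.inv.posSemidef.nonneg
  rw [Matrix.star_eq_conjTranspose] at hC
  have hps := hB.mul_mul_conjTranspose_same C
  have e : (W⁻¹ * B).trace = (C * B * C.conjTranspose).trace := by
    rw [hC, Matrix.mul_assoc, Matrix.trace_mul_comm]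
  rw [e]
  refine lt_of_le_of_ne hps.trace_nonneg (Ne.symm ?_)
  rw [Ne, hps.trace_eq_zero_iff]
  intro h0
  have hu : IsUnit C := by
    have h1 : IsUnit (C.conjTranspose * C) := hC ▸ hW.inv.isUnit
    rw [Matrix.isUnit_iff_isUnit_det] at h1 ⊢
    rw [Matrix.det_mul] at h1
    exact isUnit_of_mul_isUnit_right h1
  have hu' : IsUnit C.conjTranspose := hu.star
  apply hB0
  have h1 : C * B = 0 := by
    rwa [hu'.mul_left_eq_zero] at h0
  rwa [hu.mul_right_eq_zero] at h1

lemma Dc_one (hn : 1 ≤ n) (hW : W.PosDef) (B : Matrix (Fin n) (Fin n) ℂ)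
    (hB : B.PosSemidef) (hB0 : B ≠ 0) :
    0 < (Dc n (B :: List.replicate (n - 1) W)).re := by
  have h1 : ∀ t : ℂ, (W + t • B).det = (polyOf n (cf n n [] W B)).eval t := by
    intro t
    rw [polyOf_eval, ← Dc_expand n hn _ _ _ _ _ (by simp), List.append_nil, Dc_diag]
  have hu : IsUnit W.det := (Matrix.isUnit_iff_isUnit_det _).1 hW.isUnit
  have h2 : ∀ t : ℂ, (W + t • B).det = W.det * (1 + t • (W⁻¹ * B)).det := by
    intro t
    rw [← Matrix.det_mul, mul_add, mul_one, Matrix.mul_smul, ← Matrix.mul_assoc,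
      Matrix.mul_nonsing_inv _ hu, Matrix.one_mul]
  have h3 : polyOf n (cf n n [] W B) = Polynomial.C W.det *
      (1 + Polynomial.C (W⁻¹ * B).trace * Polynomial.X +
        (1 + (Polynomial.X : Polynomial ℂ) • (W⁻¹ * B).map Polynomial.C).det.divX.divX *
          Polynomial.X ^ 2) := by
    apply Polynomial.funext
    intro t
    rw [← h1, h2, Matrix.det_one_add_smul]
    simp
  have h4 := congrArg (fun p => Polynomial.coeff p 1) h3
  simp only [polyOf_coeff, if_pos hn] at h4
  have h5 : cf n n [] W B 1 = n * Dc n (B :: List.replicate (n - 1) W) := by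
    simp [cf]
  rw [h5, Polynomial.coeff_C_mul, Polynomial.coeff_add, Polynomial.coeff_add,
    Polynomial.coeff_mul_X_pow'] at h4
  simp [Polynomial.coeff_one] at h4
  have h6 : 0 < W.det * (W⁻¹ * B).trace := mul_pos hW.det_pos (trace_inv_pos hW B hB hB0)
  rw [← h4, Complex.lt_def] at h6
  have h7 := h6.1
  rw [← Complex.ofReal_natCast, Complex.re_ofReal_mul] at h7
  simp only [Complex.zero_re] at h7
  exact pos_of_mul_pos_right h7 (by positivity)

lemma psd_pos (hn : 1 ≤ n) (hmn : m ≤ n) (hW : W.PosDef) (B : Matrix (Fin n) (Fin n) ℂ)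
    (hB : B.PosSemidef) (hB0 : B ≠ 0)
    (L : List (Matrix (Fin n) (Fin n) ℂ)) (hL : ∀ a ∈ L, a ∈ GS n m W) :
    ∀ j, 1 + L.length + j = m →
      0 < (Dc n (B :: (L ++ (List.replicate j W ++ List.replicate (n - m) W)))).re := by
  induction L with
  | nil =>
    intro j hj
    simp only [List.length_nil] at hj
    rw [List.nil_append, ← List.replicate_add]
    have e : j + (n - m) = n - 1 := by omega
    rw [e]
    exact Dc_one hn hW B hB hB0
  | cons a L ih =>
    intro j hj
    simp only [List.length_cons] at hj
    have hWG : W ∈ GS n m W := GS_posDef hn hmn hW W hW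
    have hL' : ∀ a ∈ L, a ∈ GS n m W := fun a ha => hL a (List.mem_cons_of_mem _ ha)
    obtain ⟨ε, hε, h⟩ := GS_eps hW a (hL a List.mem_cons_self)
    have h2 := ih hL' (j + 1) (by omega)
    have h1 := closure_nonneg hn hmn hW [B] (by
      intro b hb
      rw [List.mem_singleton] at hb
      subst hb
      exact psd_closure hn hmn hW b hB) ((a - (ε : ℂ) • W) :: (L ++ List.replicate j W)) (by
        intro c hc
        rcases List.mem_cons.1 hc with rfl | hc
        · exact h
        · rcases List.mem_append.1 hc with hc | hc
          · exact hL' c hc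
          · rw [(List.mem_replicate.1 hc).2]; exact hWG) (by simp; omega)
    set T := L ++ (List.replicate j W ++ List.replicate (n - m) W) with hT
    have hTl : T.length + 2 = n := by simp [hT]; omega
    have e1 : ∀ c, Dc n (B :: c :: T) = Dc n (c :: B :: T) := fun c =>
      Dc_perm n (List.Perm.swap _ _ _) (by simp; omega)
    have e2 : a = (a - (ε : ℂ) • W) + (ε : ℂ) • W := by simp
    have e3 : Dc n (B :: (L ++ (List.replicate (j + 1) W ++ List.replicate (n - m) W))) =
        Dc n (B :: W :: T) := by
      refine Dc_perm n (List.Perm.cons _ ?_) (by simp; omega)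
      rw [List.replicate_succ, List.cons_append]
      exact List.perm_middle
    rw [e3, e1] at h2
    have h1' : 0 ≤ (Dc n (B :: (a - (ε : ℂ) • W) :: T)).re := by
      simpa [hT] using h1
    rw [e1] at h1'
    rw [List.cons_append, e1, e2, Dc_lin n hn, Complex.add_re, Complex.re_ofReal_mul]
    have := mul_pos hε h2
    linarith

end final

/-- Positivity of mixed discriminants of `m`-positive Hermitian
matrices with respect to a positive definite Hermitian matrix `W`. -/
theorem statement10 (n m : ℕ) (hn : 1 ≤ n) (hm : 1 ≤ m) (hmn : m ≤ n)
    (W : Matrix (Fin n) (Fin n) ℂ) (hW : W.PosDef) :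
    (∀ A : Fin m → Matrix (Fin n) (Fin n) ℂ,
        (∀ i, (A i).IsHermitian) → (∀ i, IsMPos n m W (A i)) →
        0 < mixedDisc n (List.ofFn (fun i => A i) ++ List.replicate (n - m) W)) ∧
    (∀ A : Fin (m - 1) → Matrix (Fin n) (Fin n) ℂ,
        (∀ i, (A i).IsHermitian) → (∀ i, IsMPos n m W (A i)) →
        ∀ B : Matrix (Fin n) (Fin n) ℂ, B.PosSemidef → B ≠ 0 →
        0 < mixedDisc n (B :: (List.ofFn (fun i => A i) ++ List.replicate (n - m) W))) ∧
    (∀ p : ℕ, p ≤ m →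
        ∀ A : Fin p → Matrix (Fin n) (Fin n) ℂ,
        (∀ i, (A i).IsHermitian ∧
          A i ∈ closure {X : Matrix (Fin n) (Fin n) ℂ | X.IsHermitian ∧ IsMPos n m W X}) →
        ∀ B : Fin (m - p) → Matrix (Fin n) (Fin n) ℂ, (∀ j, (B j).PosSemidef) →
        0 ≤ mixedDisc n (List.ofFn (fun i => A i) ++ List.ofFn (fun j => B j) ++
          List.replicate (n - m) W)) := by
  have hG : ∀ A : Matrix (Fin n) (Fin n) ℂ, A.IsHermitian → IsMPos n m W A → A ∈ GS n m W :=
    fun A h1 h2 => GS_of_mpos hn hm hmn hW A h1 h2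
  refine ⟨?_, ?_, ?_⟩
  · intro A hA hP
    rw [mixedDisc_eq]
    refine GS_pos hn hmn hW _ ?_ (by simp)
    intro a ha
    obtain ⟨i, rfl⟩ := (List.mem_ofFn' _ _).1 ha
    exact hG _ (hA i) (hP i)
  · intro A hA hP B hB hB0
    rw [mixedDisc_eq]
    have := psd_pos hn hmn hW B hB hB0 (List.ofFn fun i => A i) (by
      intro a ha
      obtain ⟨i, rfl⟩ := (List.mem_ofFn' _ _).1 ha
      exact hG _ (hA i) (hP i)) 0 (by simp; omega)
    simpa using this
  · intro p hp A hA B hB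
    rw [mixedDisc_eq]
    have := closure_nonneg hn hmn hW (List.ofFn (fun i => A i) ++ List.ofFn (fun j => B j)) (by
      intro a ha
      rcases List.mem_append.1 ha with ha | ha
      · obtain ⟨i, rfl⟩ := (List.mem_ofFn' _ _).1 ha
        exact closure_mono (fun X hX => hG X hX.1 hX.2) (hA i).2
      · obtain ⟨i, rfl⟩ := (List.mem_ofFn' _ _).1 ha
        exact psd_closure hn hmn hW _ (hB i)) [] (by simp) (by simp; omega)
    simpa using this

end MixedDiscPaper
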